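/- arXiv:2406.00643 — 2 statements merged into one kernel-verified Lean document; each statement's English description precedes it below -/
import Mathlib

section
/- Let G be a connected block graph having at least one cut-vertex. Then Γ(G) = max{ ω(G), max_w Γ_G(w) }, where the inner maximum is taken over all cut-vertices w of G. -/
open SimpleGraph

variable {V : Type*}

/-- A Grundy (First-Fit) coloring of `G` with `k` colors: a proper coloring with colors
`1, …, k`, all color classes nonempty, such that every vertex of color `j` has a neighbor
of each color `i < j` (with `i ≥ 1`). -/
def IsGrundyColoring (G : SimpleGraph V) (c : V → ℕ) (k : ℕ) : Prop :=
  (∀ v, c v ∈ Finset.Icc 1 k) ∧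
  (∀ ⦃x y⦄, G.Adj x y → c x ≠ c y) ∧
  (∀ i ∈ Finset.Icc 1 k, ∃ v, c v = i) ∧
  (∀ v, ∀ i ∈ Finset.Ico 1 (c v), ∃ w, G.Adj v w ∧ c w = i)

/-- The Grundy (First-Fit) chromatic number `Γ(G)`. -/
noncomputable def grundyNumber (G : SimpleGraph V) : ℕ :=
  sSup {k | ∃ c, IsGrundyColoring G c k}

/-- `Γ_G(u)`: the largest color that `u` can receive in a Grundy coloring of `G`. -/
noncomputable def grundyAt (G : SimpleGraph V) (u : V) : ℕ :=
  sSup {j | ∃ c k, IsGrundyColoring G c k ∧ c u = j}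

/-- `v` is a cut-vertex of `G`: deleting `v` disconnects (for connected `G`, increases the
number of connected components). -/
def IsCutVertex (G : SimpleGraph V) (v : V) : Prop :=
  ¬ (G.induce {w | w ≠ v}).Connected

/-- A block of `G`: a maximal vertex set of size at least two inducing a connected subgraph
with no cut-vertex (i.e. a maximal 2-connected subgraph or a bridge with its endpoints). -/
def IsBlock (G : SimpleGraph V) (B : Set V) : Prop :=
  Maximal (fun A : Set V => 2 ≤ A.ncard ∧ (G.induce A).Connected ∧
    ∀ v ∈ A, (G.induce (A \ {v})).Connected) B

/-- A block graph: a connected graph every block of which is complete. -/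
def IsBlockGraph (G : SimpleGraph V) : Prop :=
  G.Connected ∧ ∀ B : Set V, IsBlock G B → ∀ u ∈ B, ∀ v ∈ B, u ≠ v → G.Adj u v

/-- The number of blocks of `G` containing `v` (the degree of a cut-vertex `v` in the
block-cutpoint graph). -/
noncomputable def blockDegree (G : SimpleGraph V) (v : V) : ℕ :=
  {B : Set V | IsBlock G B ∧ v ∈ B}.ncard

/-- `Δ̃(G)`: the maximum over all cut-vertices `v` of the number of blocks containing `v`. -/
noncomputable def maxCutBlockDegree (G : SimpleGraph V) : ℕ :=
  sSup {n | ∃ v, IsCutVertex G v ∧ blockDegree G v = n}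

/-- The ball `B(u, r)` of radius `r` centered at `u`. -/
def gball (G : SimpleGraph V) (u : V) (r : ℕ) : Set V :=
  {v | G.Reachable u v ∧ G.dist u v ≤ r}

lemma mem_gball_self (G : SimpleGraph V) (u : V) (r : ℕ) : u ∈ gball G u r :=
  ⟨Reachable.refl u, by simp [SimpleGraph.dist_self]⟩

/-- The degree of a vertex. -/
noncomputable def deg (G : SimpleGraph V) (v : V) : ℕ := (G.neighborSet v).ncard

/-- `Δ(u) = max {d(v) : v ∈ N(u), d(v) ≤ d(u)}`, equal to `0` if no such neighbor exists. -/
noncomputable def maxSmallNbrDeg (G : SimpleGraph V) (u : V) : ℕ :=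
  sSup {d | ∃ v, G.Adj u v ∧ deg G v ≤ deg G u ∧ deg G v = d}

/-- `Δ₂(G) = max_{u} Δ(u)`. -/
noncomputable def delta2 (G : SimpleGraph V) : ℕ :=
  sSup {d | ∃ u, maxSmallNbrDeg G u = d}

/-- The maximum number of vertices of a block of `G`. -/
noncomputable def maxBlockSize (G : SimpleGraph V) : ℕ :=
  sSup {n | ∃ B, IsBlock G B ∧ B.ncard = n}


lemma path_aux (G : SimpleGraph V) (u : V) {x y : V} (p : G.Walk x y) (hp : p.IsPath) :
    ∀ w ∈ p.support, w ≠ u → ∃ z, (z = x ∨ z = y) ∧ ∃ r : G.Walk w z,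
      ∀ t ∈ r.support, t ∈ p.support ∧ t ≠ u := by
  classical
  induction p with
  | nil =>
    intro w hw hwu
    simp at hw
    subst hw
    exact ⟨w, Or.inl rfl, Walk.nil, by simp [hwu]⟩
  | @cons a b d h q ih =>
    intro w hw hwu
    rw [Walk.cons_isPath_iff] at hp
    by_cases hwa : w = a
    · subst hwa
      exact ⟨w, Or.inl rfl, Walk.nil, by simp [hwu]⟩
    have hwq : w ∈ q.support := by simpa [hwa] using hw
    by_cases hua : a = u
    · subst hua
      refine ⟨d, Or.inr rfl, q.dropUntil w hwq, ?_⟩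
      intro t ht
      have htq := q.support_dropUntil_subset_support hwq ht
      refine ⟨by simp [htq], ?_⟩
      rintro rfl
      exact hp.2 htq
    · obtain ⟨z, hz, r, hr⟩ := ih hp.1 w hwq hwu
      rcases hz with rfl | rfl
      · refine ⟨a, Or.inl rfl, r.concat h.symm, ?_⟩
        intro t ht
        rw [Walk.support_concat] at ht
        simp at ht
        rcases ht with ht | rfl
        · exact ⟨by simp [(hr t ht).1], (hr t ht).2⟩
        · exact ⟨by simp, hua⟩
      · exact ⟨z, Or.inr rfl, r, fun t ht => ⟨by simp [(hr t ht).1], (hr t ht).2⟩⟩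

lemma conn_of_walks (G : SimpleGraph V) (s : Set V) (u : V) (hu : u ∈ s)
    (h : ∀ w ∈ s, ∃ r : G.Walk w u, ∀ t ∈ r.support, t ∈ s) : (G.induce s).Connected := by
  refine induce_connected_of_patches u hu ?_
  intro w hw
  obtain ⟨r, hr⟩ := h w hw
  exact ⟨s, subset_rfl, hu, hw, ⟨(r.induce s hr).reverse⟩⟩

lemma nbrs_adj [Fintype V] (G : SimpleGraph V) (hBG : IsBlockGraph G) (v : V)
    (hv : ¬ IsCutVertex G v) (x y : V) (hx : G.Adj v x) (hy : G.Adj v y) (hxy : x ≠ y) :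
    G.Adj x y := by
  classical
  unfold IsCutVertex at hv
  rw [not_not] at hv
  obtain ⟨p0, hp0⟩ := (hv.preconnected ⟨x, hx.ne'⟩ ⟨y, hy.ne'⟩).exists_isPath
  obtain ⟨p, hp, hvp⟩ : ∃ p : G.Walk x y, p.IsPath ∧ v ∉ p.support := by
    refine ⟨p0.map (Embedding.induce _).toHom, ?_, ?_⟩
    · exact Walk.map_isPath_of_injective Subtype.val_injective hp0
    · intro h
      erw [Walk.support_map] at h
      rw [List.mem_map] at h
      obtain ⟨a, -, ha⟩ := h
      exact a.2 ha
  let A : Set V := insert v {w | w ∈ p.support}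
  have hvA : v ∈ A := Or.inl rfl
  have hxA : x ∈ A := Or.inr p.start_mem_support
  have hyA : y ∈ A := Or.inr p.end_mem_support
  have hdel : ∀ u, u ≠ v → (G.induce (A \ {u})).Connected := by
    intro u huv
    refine conn_of_walks G _ v ⟨hvA, huv.symm⟩ ?_
    rintro w ⟨hw, hwu⟩
    rcases hw with rfl | hw
    · exact ⟨Walk.nil, by simpa using ⟨hvA, huv.symm⟩⟩
    obtain ⟨z, hz, r, hr⟩ := path_aux G u p hp w hw hwu
    have hzv : G.Adj z v := by
      rcases hz with rfl | rfl
      · exact hx.symm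
      · exact hy.symm
    refine ⟨r.concat hzv, ?_⟩
    intro t ht
    rw [Walk.support_concat] at ht
    simp at ht
    rcases ht with ht | rfl
    · exact ⟨Or.inr (hr t ht).1, (hr t ht).2⟩
    · exact ⟨hvA, huv.symm⟩
  have hP : (fun A : Set V => 2 ≤ A.ncard ∧ (G.induce A).Connected ∧
    ∀ v ∈ A, (G.induce (A \ {v})).Connected) A := by
    refine ⟨?_, ?_, ?_⟩
    · exact (Set.one_lt_ncard (Set.toFinite A)).2 ⟨x, hxA, y, hyA, hxy⟩
    · refine conn_of_walks G _ v hvA ?_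
      rintro w (rfl | hw)
      · exact ⟨Walk.nil, by simpa using hvA⟩
      refine ⟨(p.dropUntil w hw).concat hy.symm, ?_⟩
      intro t ht
      rw [Walk.support_concat] at ht
      simp at ht
      rcases ht with ht | rfl
      · exact Or.inr (p.support_dropUntil_subset_support hw ht)
      · exact hvA
    · intro u hu
      by_cases huv : u = v
      · subst huv
        refine conn_of_walks G _ y ⟨hyA, hy.ne'⟩ ?_
        rintro w ⟨hw, hwu⟩
        have hw : w ∈ p.support := hw.resolve_left hwu
        refine ⟨p.dropUntil w hw, ?_⟩
        intro t ht
        have := p.support_dropUntil_subset_support hw ht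
        refine ⟨Or.inr this, ?_⟩
        rintro rfl
        exact hvp this
      · exact hdel u huv
  obtain ⟨B, hAB, hB⟩ := Finite.exists_le_maximal
    (p := fun A : Set V => 2 ≤ A.ncard ∧ (G.induce A).Connected ∧
      ∀ v ∈ A, (G.induce (A \ {v})).Connected) hP
  exact hBG.2 B hB x (hAB hxA) y (hAB hyA) hxy

lemma grundy_extend [Fintype V] [Nonempty V] (G : SimpleGraph V) :
    ∀ (n : ℕ) (c : V → ℕ), {v | c v = 0}.ncard = n →
    (∀ ⦃x y⦄, G.Adj x y → c x ≠ 0 → c x ≠ c y) →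
    (∀ v, ∀ i ∈ Finset.Ico 1 (c v), ∃ w, G.Adj v w ∧ c w = i) →
    ∃ c' k, IsGrundyColoring G c' k ∧ ∀ v, c v ≤ k := by
  classical
  intro n
  induction n with
  | zero =>
    intro c h0 h1 h2
    rw [Set.ncard_eq_zero (Set.toFinite _)] at h0
    have hpos : ∀ v, c v ≠ 0 := fun v hv => by
      have : v ∈ {v | c v = 0} := hv
      rw [h0] at this
      exact this
    obtain ⟨m, hm⟩ := Finite.exists_max c
    refine ⟨c, c m, ⟨?_, ?_, ?_, h2⟩, hm⟩
    · intro v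
      exact Finset.mem_Icc.2 ⟨Nat.one_le_iff_ne_zero.2 (hpos v), hm v⟩
    · intro x y h
      exact h1 h (hpos x)
    · intro i hi
      rw [Finset.mem_Icc] at hi
      rcases hi.2.eq_or_lt with h | h
      · exact ⟨m, h.symm⟩
      · obtain ⟨w, -, hw⟩ := h2 m i (Finset.mem_Ico.2 ⟨hi.1, h⟩)
        exact ⟨w, hw⟩
  | succ n ih =>
    intro c h0 h1 h2
    obtain ⟨v, hv⟩ : {v | c v = 0}.Nonempty := by
      apply Set.nonempty_of_ncard_ne_zero
      omega
    have hv : c v = 0 := hv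
    have hex : ∃ m, 1 ≤ m ∧ ∀ w, G.Adj v w → c w ≠ m := by
      obtain ⟨m, hm⟩ := Finite.exists_max c
      refine ⟨c m + 1, by omega, fun w _ => ?_⟩
      have := hm w
      omega
    have hf := Nat.find_spec hex
    have hmin : ∀ i, i < Nat.find hex → ¬ _ := fun i hi => Nat.find_min hex hi
    generalize Nat.find hex = m at hf hmin
    have hle : ∀ w, c w ≤ Function.update c v m w := by
      intro w
      by_cases hw : w = v
      · subst hw; simp [hv]
      · simp [hw]
    have key : {w | Function.update c v m w = 0} = {w | c w = 0} \ {v} := by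
      ext w
      by_cases hw : w = v
      · subst hw; simp; omega
      · simp [hw]
    obtain ⟨c', k, hc', hk⟩ := ih (Function.update c v m) (by
        rw [key, Set.ncard_diff_singleton_of_mem (by exact hv), h0]; rfl) (by
        intro x y hxy hx
        by_cases hxv : x = v
        · subst hxv
          have := hf.2 y hxy
          simp [hxy.ne']
          exact this.symm
        · by_cases hyv : y = v
          · subst hyv
            simp [hxv]
            exact hf.2 x hxy.symm
          · simp [hxv, hyv] at hx ⊢
            exact h1 hxy hx) (by
        have hstep : ∀ x i, 1 ≤ i → (∃ w, G.Adj x w ∧ c w = i) →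
            ∃ w, G.Adj x w ∧ Function.update c v m w = i := by
          rintro x i hi ⟨w, hw, hwi⟩
          refine ⟨w, hw, ?_⟩
          have : w ≠ v := by rintro rfl; omega
          simpa [this] using hwi
        intro x i hi
        rw [Finset.mem_Ico] at hi
        apply hstep x i hi.1
        by_cases hxv : x = v
        · subst hxv
          simp at hi
          have := hmin i hi.2
          push Not at this
          exact this hi.1
        · simp [hxv] at hi
          exact h2 x i (Finset.mem_Ico.2 hi))
    exact ⟨c', k, hc', fun w => (hle w).trans (hk w)⟩

lemma grundy_le_card [Fintype V] (G : SimpleGraph V) {c : V → ℕ} {k : ℕ}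
    (h : IsGrundyColoring G c k) : k ≤ Fintype.card V := by
  classical
  have : Finset.Icc 1 k ⊆ Finset.univ.image c := by
    intro i hi
    obtain ⟨v, hv⟩ := h.2.2.1 i hi
    simp [← hv]
  have h1 := Finset.card_le_card this
  have h2 := Finset.card_image_le (s := Finset.univ) (f := c)
  simp at h1 h2
  exact h1.trans h2

lemma clique_le_grundy [Fintype V] [Nonempty V] (G : SimpleGraph V) (s : Finset V)
    (hs : G.IsClique s) : ∃ c k, IsGrundyColoring G c k ∧ s.card ≤ k := by
  classical
  let c : V → ℕ := fun v => if h : v ∈ s then (s.equivFin ⟨v, h⟩ : ℕ) + 1 else 0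
  have hc : ∀ v (h : v ∈ s), c v = (s.equivFin ⟨v, h⟩ : ℕ) + 1 := fun v h => by simp [c, h]
  have hc0 : ∀ v, v ∉ s → c v = 0 := fun v h => by simp [c, h]
  have hinv : ∀ i, 1 ≤ i → i ≤ s.card → ∃ w ∈ s, c w = i := by
    intro i h1 h2
    refine ⟨s.equivFin.symm ⟨i - 1, by omega⟩, Subtype.coe_prop _, ?_⟩
    rw [hc _ (Subtype.coe_prop _)]
    simp
    omega
  obtain ⟨c', k, h, hk⟩ := grundy_extend G _ c rfl (by
      intro x y hxy hx heq
      have hxs : x ∈ s := by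
        by_contra h
        exact hx (hc0 x h)
      have hys : y ∈ s := by
        by_contra h
        exact hx (heq.trans (hc0 y h))
      rw [hc x hxs, hc y hys] at heq
      have := s.equivFin.injective (Fin.ext (Nat.succ_injective heq))
      exact hxy.ne (congrArg Subtype.val this)) (by
      intro v i hi
      rw [Finset.mem_Ico] at hi
      have hvs : v ∈ s := by
        by_contra h
        rw [hc0 v h] at hi
        omega
      have hb : c v ≤ s.card := by
        rw [hc v hvs]
        exact (s.equivFin ⟨v, hvs⟩).2
      obtain ⟨w, hw, hwi⟩ := hinv i hi.1 (by omega)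
      refine ⟨w, hs hvs hw ?_, hwi⟩
      rintro rfl
      omega)
  refine ⟨c', k, h, ?_⟩
  rcases Nat.eq_zero_or_pos s.card with h0 | h0
  · omega
  · obtain ⟨w, -, hw⟩ := hinv s.card h0 le_rfl
    rw [← hw]
    exact hk w

/-- For a connected block graph with at least one cut-vertex,
`Γ(G) = max {ω(G), max_w Γ_G(w)}`, the inner maximum over all cut-vertices `w`. -/
theorem statement_4 [Fintype V] (G : SimpleGraph V) (hBG : IsBlockGraph G)
    (hcut : ∃ v, IsCutVertex G v) :
    grundyNumber G =
      max (G.cliqueNum) (sSup {j | ∃ w, IsCutVertex G w ∧ grundyAt G w = j}) := by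
  classical
  haveI : Nonempty V := hBG.1.nonempty
  have hbd : BddAbove {k | ∃ c, IsGrundyColoring G c k} :=
    ⟨Fintype.card V, by rintro k ⟨c, h⟩; exact grundy_le_card G h⟩
  have hAt : ∀ w, grundyAt G w ≤ grundyNumber G := by
    intro w
    apply csSup_le'
    rintro j ⟨c, k, h, rfl⟩
    exact (Finset.mem_Icc.1 (h.1 w)).2.trans (le_csSup hbd ⟨c, h⟩)
  apply le_antisymm
  · apply csSup_le'
    rintro k ⟨c, h⟩
    rcases Nat.eq_zero_or_pos k with rfl | hk
    · exact Nat.zero_le _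
    obtain ⟨v, hv⟩ := h.2.2.1 k (Finset.mem_Icc.2 ⟨hk, le_rfl⟩)
    by_cases hcv : IsCutVertex G v
    · apply le_max_of_le_right
      have h1 : k ≤ grundyAt G v := by
        refine le_csSup ⟨Fintype.card V, ?_⟩ ⟨c, k, h, hv⟩
        rintro j ⟨c, k, h, rfl⟩
        exact (Finset.mem_Icc.1 (h.1 v)).2.trans (grundy_le_card G h)
      refine h1.trans (le_csSup ⟨grundyNumber G, ?_⟩ ⟨v, hcv, rfl⟩)
      rintro j ⟨w, -, rfl⟩
      exact hAt w
    · apply le_max_of_le_left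
      have hcl : G.IsClique (insert v (G.neighborFinset v) : Finset V) := by
        intro x hx y hy hxy
        simp at hx hy
        rcases hx with rfl | hx
        · rcases hy with rfl | hy
          · exact absurd rfl hxy
          · exact hy
        · rcases hy with rfl | hy
          · exact hx.symm
          · exact nbrs_adj G hBG v hcv x y hx hy hxy
      refine le_trans ?_ hcl.card_le_cliqueNum
      have hsub : Finset.Icc 1 k ⊆ (insert v (G.neighborFinset v)).image c := by
        intro i hi
        rw [Finset.mem_Icc] at hi
        rw [Finset.mem_image]
        rcases hi.2.eq_or_lt with h' | h'
        · exact ⟨v, by simp, by omega⟩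
        · obtain ⟨w, hw, hwi⟩ := h.2.2.2 v i (Finset.mem_Ico.2 ⟨hi.1, by omega⟩)
          exact ⟨w, by simp [hw], hwi⟩
      have h1 := Finset.card_le_card hsub
      have h2 := h1.trans Finset.card_image_le
      simpa using h2
  · apply max_le
    · obtain ⟨s, hs⟩ := G.exists_isNClique_cliqueNum
      obtain ⟨c, k, h, hk⟩ := clique_le_grundy G s hs.isClique
      rw [hs.card_eq] at hk
      exact hk.trans (le_csSup hbd ⟨c, h⟩)
    · apply csSup_le'
      rintro j ⟨w, -, rfl⟩
      exact hAt w
end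

section
/- Let G be a finite simple graph with at least one vertex and let p ≥ 2 be an integer. Let H be the graph obtained from G by attaching to each vertex u of G a new complete graph K_p(u) isomorphic to K_p, where u is identified with one vertex of K_p(u) and the copies K_p(u) for distinct vertices u are pairwise vertex-disjoint and share no vertices with G other than u. Then Γ(H) = Γ(G) + p − 1. -/
open SimpleGraph

variable {V : Type*}

/-- The graph obtained from `G` by attaching a disjoint copy of `K_p` at every vertex `u` of
`G` (identifying `u` with one vertex of its copy): the new vertices are the pairs
`(u, i)` with `i : Fin (p-1)`. -/
def attachCliques (G : SimpleGraph V) (p : ℕ) : SimpleGraph (V ⊕ V × Fin (p - 1)) :=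
  SimpleGraph.fromRel (fun x y =>
    match x, y with
    | Sum.inl u, Sum.inl v => G.Adj u v
    | Sum.inl u, Sum.inr q => u = q.1
    | Sum.inr _, Sum.inl _ => False
    | Sum.inr q, Sum.inr r => q.1 = r.1)


/-- A partial Grundy coloring, where color `0` means uncolored. -/
def PartialGrundy {W : Type*} (G : SimpleGraph W) (f : W → ℕ) : Prop :=
  (∀ x y, G.Adj x y → f x ≠ 0 → f x ≠ f y) ∧
  (∀ v i, 1 ≤ i → i < f v → ∃ w, G.Adj v w ∧ f w = i)

lemma PartialGrundy.extend {W : Type*} [Fintype W] (G : SimpleGraph W) (n : ℕ) :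
    ∀ f : W → ℕ, PartialGrundy G f → (Finset.univ.filter (fun v => f v = 0)).card = n →
    ∃ g : W → ℕ, PartialGrundy G g ∧ (∀ v, g v ≠ 0) ∧ ∀ v, f v ≠ 0 → g v = f v := by
  classical
  induction n with
  | zero =>
    intro f hf h0
    refine ⟨f, hf, ?_, fun _ _ => rfl⟩
    intro v hv
    rw [Finset.card_eq_zero] at h0
    have : v ∈ (Finset.univ.filter (fun v => f v = 0)) := by simp [hv]
    rw [h0] at this
    simp at this
  | succ n ih =>
    intro f hf hn
    have hne : (Finset.univ.filter (fun v => f v = 0)).Nonempty := by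
      rw [← Finset.card_pos]; omega
    obtain ⟨v, hv⟩ := hne
    have hv0 : f v = 0 := by simpa using hv
    have hex : ∃ m, m ∉ insert 0 (Finset.univ.image f) := Infinite.exists_notMem_finset _
    have hex2 : ∃ m, 1 ≤ m ∧ ∀ w, G.Adj v w → f w ≠ m := by
      obtain ⟨m, hm⟩ := hex
      simp only [Finset.mem_insert, Finset.mem_image, Finset.mem_univ, true_and, not_or,
        not_exists] at hm
      exact ⟨m, by omega, fun w _ => hm.2 w⟩
    obtain ⟨m, hm1, hm2, hmin⟩ : ∃ m, 1 ≤ m ∧ (∀ w, G.Adj v w → f w ≠ m) ∧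
        ∀ i, 1 ≤ i → i < m → ∃ w, G.Adj v w ∧ f w = i := by
      refine ⟨Nat.find hex2, (Nat.find_spec hex2).1, (Nat.find_spec hex2).2, ?_⟩
      intro i hi him
      have := Nat.find_min hex2 him
      push Not at this
      exact this hi
    have hA : PartialGrundy G (Function.update f v m) := by
      constructor
      · intro x y hxy hx
        by_cases hxv : x = v
        · subst hxv
          have hyx : y ≠ x := hxy.ne'
          rw [Function.update_self, Function.update_of_ne hyx]
          exact (hm2 y hxy).symm
        · rw [Function.update_of_ne hxv] at hx ⊢
          by_cases hyv : y = v
          · subst hyv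
            rw [Function.update_self]
            exact hm2 x hxy.symm
          · rw [Function.update_of_ne hyv]
            exact hf.1 x y hxy hx
      · intro x i hi hix
        have key : ∃ w, G.Adj x w ∧ f w = i := by
          by_cases hxv : x = v
          · subst hxv
            rw [Function.update_self] at hix
            exact hmin i hi hix
          · rw [Function.update_of_ne hxv] at hix
            exact hf.2 x i hi hix
        obtain ⟨w, hw, hwi⟩ := key
        refine ⟨w, hw, ?_⟩
        have : w ≠ v := by rintro rfl; omega
        rw [Function.update_of_ne this, hwi]
    have hB : (Finset.univ.filter (fun w => Function.update f v m w = 0)).card = n := by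
      have : (Finset.univ.filter (fun w => Function.update f v m w = 0)) =
          (Finset.univ.filter (fun w => f w = 0)).erase v := by
        ext w
        by_cases hwv : w = v
        · subst hwv; simp; omega
        · simp [hwv]
      rw [this, Finset.card_erase_of_mem hv, hn]
      rfl
    obtain ⟨g, hg, hg0, hgf⟩ := ih (Function.update f v m) hA hB
    refine ⟨g, hg, hg0, fun w hw => ?_⟩
    have hwv : w ≠ v := by rintro rfl; exact hw hv0
    have := hgf w
    rw [Function.update_of_ne hwv] at this
    exact this hw

lemma grundy_bdd {W : Type*} [Fintype W] (G : SimpleGraph W) :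
    BddAbove {k | ∃ c, IsGrundyColoring G c k} := by
  classical
  refine ⟨Fintype.card W, ?_⟩
  rintro k ⟨c, _, _, h, _⟩
  have : Finset.Icc 1 k ⊆ Finset.univ.image c := by
    intro i hi
    simpa using h i hi
  have := Finset.card_le_card this
  have h2 := Finset.card_image_le (s := (Finset.univ : Finset W)) (f := c)
  rw [Nat.card_Icc] at this
  rw [Finset.card_univ] at h2
  omega

lemma PartialGrundy.total {W : Type*} [Fintype W] [Nonempty W] (G : SimpleGraph W) (g : W → ℕ)
    (hg : PartialGrundy G g) (h0 : ∀ v, g v ≠ 0) :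
    ∃ k, (∀ v, g v ≤ k) ∧ IsGrundyColoring G g k := by
  obtain ⟨m, hm⟩ := Finite.exists_max g
  refine ⟨g m, hm, ?_, ?_, ?_, ?_⟩
  · intro v
    have := h0 v
    have := hm v
    simp only [Finset.mem_Icc]; omega
  · intro x y h; exact hg.1 x y h (h0 x)
  · intro i hi
    simp only [Finset.mem_Icc] at hi
    rcases hi.2.lt_or_eq with h | h
    · obtain ⟨w, _, hw⟩ := hg.2 m i hi.1 h
      exact ⟨w, hw⟩
    · exact ⟨m, h.symm⟩
  · intro v i hi
    simp only [Finset.mem_Ico] at hi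
    exact hg.2 v i hi.1 hi.2

lemma PartialGrundy.le {W : Type*} [Fintype W] (G : SimpleGraph W) (f : W → ℕ)
    (hf : PartialGrundy G f) (v : W) : f v ≤ grundyNumber G ∧ 1 ≤ grundyNumber G := by
  have : Nonempty W := ⟨v⟩
  obtain ⟨g, hg, h0, hgf⟩ := PartialGrundy.extend G _ f hf rfl
  obtain ⟨k, hk, hG⟩ := hg.total G g h0
  have h1 : k ≤ grundyNumber G := le_csSup (grundy_bdd G) ⟨g, hG⟩
  have h2 := hk v
  have h3 := h0 v
  have h4 := hgf v
  constructor
  · by_cases h : f v = 0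
    · omega
    · have := h4 h; omega
  · omega

lemma attach_ll {V : Type*} (G : SimpleGraph V) (p : ℕ) (u v : V) :
    (attachCliques G p).Adj (Sum.inl u) (Sum.inl v) ↔ G.Adj u v := by
  simp only [attachCliques, SimpleGraph.fromRel_adj]
  constructor
  · rintro ⟨_, h | h⟩
    exacts [h, h.symm]
  · intro h
    exact ⟨by simpa using h.ne, Or.inl h⟩

lemma attach_lr {V : Type*} (G : SimpleGraph V) (p : ℕ) (u : V) (q : V × Fin (p - 1)) :
    (attachCliques G p).Adj (Sum.inl u) (Sum.inr q) ↔ u = q.1 := by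
  simp [attachCliques, SimpleGraph.fromRel_adj]

lemma attach_rr {V : Type*} (G : SimpleGraph V) (p : ℕ) (q r : V × Fin (p - 1)) :
    (attachCliques G p).Adj (Sum.inr q) (Sum.inr r) ↔ q.1 = r.1 ∧ q.2 ≠ r.2 := by
  simp only [attachCliques, SimpleGraph.fromRel_adj]
  constructor
  · rintro ⟨h, h' | h'⟩
    · exact ⟨h', fun h2 => h (congrArg _ (Prod.ext h' h2))⟩
    · exact ⟨h'.symm, fun h2 => h (congrArg _ (Prod.ext h'.symm h2))⟩
  · rintro ⟨h, h'⟩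
    exact ⟨fun e => h' (by rw [Sum.inr.inj e]), Or.inl h⟩

lemma pend_card {V : Type*} (p : ℕ) (C : V ⊕ V × Fin (p - 1) → ℕ)
    (u : V) (a : Fin (p - 1)) :
    (((Finset.univ : Finset (Fin (p-1))).erase a).image (fun b => C (Sum.inr (u, b)))).card
      ≤ p - 2 := by
  refine Finset.card_image_le.trans ?_
  rw [Finset.card_erase_of_mem (Finset.mem_univ _), Finset.card_univ, Fintype.card_fin]
  omega

lemma upper_aux {V : Type*} [Fintype V] [Nonempty V] (G : SimpleGraph V) (p : ℕ) (hp : 2 ≤ p)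
    (C : V ⊕ V × Fin (p - 1) → ℕ) (k : ℕ) (hC : IsGrundyColoring (attachCliques G p) C k) :
    k ≤ grundyNumber G + (p - 1) := by
  classical
  obtain ⟨hC1, hC2, hC3, hC4⟩ := hC
  -- pendant vertices have color at most `p`
  have hpend : ∀ u a, C (Sum.inr (u, a)) ≤ p := by
    intro u a
    have hsub : Finset.Ico 1 (C (Sum.inr (u, a))) ⊆ insert (C (Sum.inl u))
        (((Finset.univ : Finset (Fin (p-1))).erase a).image (fun b => C (Sum.inr (u, b)))) := by
      intro i hi
      obtain ⟨w, hw, hwi⟩ := hC4 _ i hi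
      rcases w with w | ⟨w, b⟩
      · have := (attach_lr G p w (u, a)).1 hw.symm
        simp only at this
        subst this
        rw [hwi]; exact Finset.mem_insert_self _ _
      · obtain ⟨h1, h2⟩ := (attach_rr G p _ _).1 hw
        simp only at h1 h2
        subst h1
        refine Finset.mem_insert_of_mem (Finset.mem_image.2 ⟨b, ?_, hwi⟩)
        simp [h2.symm]
    have h1 := Finset.card_le_card hsub
    have h2 := pend_card p C u a
    have h3 := Finset.card_insert_le (C (Sum.inl u))
        (((Finset.univ : Finset (Fin (p-1))).erase a).image (fun b => C (Sum.inr (u, b))))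
    rw [Nat.card_Ico] at h1
    omega
  have hpend2 : ∀ u a, C (Sum.inr (u, a)) < C (Sum.inl u) → C (Sum.inr (u, a)) < p := by
    intro u a hlt
    have hsub : Finset.Ico 1 (C (Sum.inr (u, a))) ⊆
        (((Finset.univ : Finset (Fin (p-1))).erase a).image (fun b => C (Sum.inr (u, b)))) := by
      intro i hi
      obtain ⟨w, hw, hwi⟩ := hC4 _ i hi
      rcases w with w | ⟨w, b⟩
      · have := (attach_lr G p w (u, a)).1 hw.symm
        simp only at this
        subst this
        rw [Finset.mem_Ico] at hi
        omega
      · obtain ⟨h1, h2⟩ := (attach_rr G p _ _).1 hw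
        simp only at h1 h2
        subst h1
        refine (Finset.mem_image.2 ⟨b, ?_, hwi⟩)
        simp [h2.symm]
    have h1 := Finset.card_le_card hsub
    have h2 := pend_card p C u a
    rw [Nat.card_Ico] at h1
    omega
  have hP : PartialGrundy G (fun u => C (Sum.inl u) - (p - 1)) := by
    constructor
    · intro x y hxy hx
      have := hC2 ((attach_ll G p x y).2 hxy)
      simp only at hx ⊢
      omega
    · intro u i hi hiu
      simp only at hiu ⊢
      obtain ⟨w, hw, hwi⟩ := hC4 (Sum.inl u) (i + (p - 1)) (by rw [Finset.mem_Ico]; omega)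
      rcases w with w | ⟨w, b⟩
      · exact ⟨w, (attach_ll G p u w).1 hw, by omega⟩
      · have := (attach_lr G p u _).1 hw
        simp only at this
        subst this
        have := hpend2 u b (by omega)
        omega
  obtain ⟨u0⟩ := ‹Nonempty V›
  have hone := (hP.le G _ u0).2
  by_cases hk : k ≤ p
  · omega
  obtain ⟨w, hw⟩ := hC3 k (by rw [Finset.mem_Icc]; omega)
  rcases w with w | ⟨w, b⟩
  · have := (hP.le G _ w).1
    omega
  · have := hpend w b
    omega

lemma lower_aux {V : Type*} [Fintype V] [Nonempty V] (G : SimpleGraph V) (p : ℕ) (hp : 2 ≤ p)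
    (c : V → ℕ) (k : ℕ) (hc : IsGrundyColoring G c k) :
    k + (p - 1) ≤ grundyNumber (attachCliques G p) := by
  classical
  obtain ⟨h1, h2, h3, h4⟩ := hc
  have hP : PartialGrundy (attachCliques G p)
      (Sum.elim (fun u => c u + (p - 1)) (fun q => q.2.val + 1)) := by
    constructor
    · rintro (x | ⟨x, a⟩) (y | ⟨y, b⟩) hxy -
      · have := h2 ((attach_ll G p x y).1 hxy)
        simpa using this
      · have := h1 x
        rw [Finset.mem_Icc] at this
        have := b.isLt
        simp only [Sum.elim_inl, Sum.elim_inr]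
        omega
      · have := h1 y
        rw [Finset.mem_Icc] at this
        have := a.isLt
        simp only [Sum.elim_inl, Sum.elim_inr]
        omega
      · have := ((attach_rr G p _ _).1 hxy).2
        simp only [Sum.elim_inr]
        intro h
        exact this (Fin.ext (by simpa using h))
    · rintro (x | ⟨x, a⟩) i hi hix
      · simp only [Sum.elim_inl] at hix
        by_cases hip : i ≤ p - 1
        · refine ⟨Sum.inr (x, ⟨i - 1, by omega⟩), (attach_lr G p _ _).2 rfl, ?_⟩
          simp only [Sum.elim_inr]
          omega
        · obtain ⟨w, hw, hwi⟩ := h4 x (i - (p - 1)) (by rw [Finset.mem_Ico]; omega)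
          refine ⟨Sum.inl w, (attach_ll G p _ _).2 hw, ?_⟩
          simp only [Sum.elim_inl]
          omega
      · simp only [Sum.elim_inr] at hix
        have := a.isLt
        refine ⟨Sum.inr (x, ⟨i - 1, by omega⟩), (attach_rr G p _ _).2 ⟨rfl, ?_⟩, ?_⟩
        · intro h
          have := congrArg Fin.val h
          simp only at this
          omega
        · simp only [Sum.elim_inr]
          omega
  obtain ⟨u0⟩ := ‹Nonempty V›
  have hk := h1 u0
  rw [Finset.mem_Icc] at hk
  obtain ⟨v, hv⟩ := h3 k (by rw [Finset.mem_Icc]; omega)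
  have := (hP.le _ _ (Sum.inl v)).1
  simp only [Sum.elim_inl] at this
  omega

lemma grundy_attained {W : Type*} [Fintype W] [Nonempty W] (G : SimpleGraph W) :
    ∃ c, IsGrundyColoring G c (grundyNumber G) := by
  have hP : PartialGrundy G (fun _ => 0) := ⟨by simp, by simp⟩
  obtain ⟨g, hg, h0, -⟩ := PartialGrundy.extend G _ _ hP rfl
  obtain ⟨k, -, hG⟩ := hg.total G g h0
  exact Nat.sSup_mem (s := {k | ∃ c, IsGrundyColoring G c k}) ⟨k, g, hG⟩ (grundy_bdd G)

/-- Attaching a copy of `K_p` (`p ≥ 2`) at every vertex of `G` increases the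
Grundy number by exactly `p − 1`. -/
theorem statement_7 [Fintype V] [Nonempty V] (G : SimpleGraph V) (p : ℕ) (hp : 2 ≤ p) :
    grundyNumber (attachCliques G p) = grundyNumber G + (p - 1) := by
  apply le_antisymm
  · obtain ⟨C, hC⟩ := grundy_attained (attachCliques G p)
    exact upper_aux G p hp C _ hC
  · obtain ⟨c, hc⟩ := grundy_attained G
    exact lower_aux G p hp c _ hc
end
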